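/- arXiv:0801.2955 — 3 statements merged into one kernel-verified Lean document; each statement's English description precedes it below -/
import Mathlib

section
/- Let K be a field and V an infinite-dimensional K-vector space. Then the canonical evaluation map eval : V → V** into the double dual, defined by eval(v)(f) = f(v), is injective but not surjective. -/
/-- For an infinite-dimensional vector space `V` over a field `K`, the
canonical evaluation map `V → V**` into the double dual is injective but not surjective. -/
theorem statement7 (K : Type*) [Field K] (V : Type*) [AddCommGroup V] [Module K V]
    (hV : ¬ FiniteDimensional K V) :
    Function.Injective (Module.Dual.eval K V) ∧
      ¬ Function.Surjective (Module.Dual.eval K V) := by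
  have hinj := Module.eval_apply_injective K (V := V)
  refine ⟨hinj, fun hsurj => hV ?_⟩
  have : Module.IsReflexive K V := ⟨hinj, hsurj⟩
  infer_instance
end

section
/- Let K be a field and V a K-vector space. The map Y ↦ Y^⊥ = {v ∈ V : φ(v) = 0 for all φ ∈ Y} is a bijection from the set of finite-dimensional subspaces Y of the dual space V* onto the set of finite-codimensional subspaces of V, i.e. the subspaces W of V such that the quotient V/W is finite-dimensional. -/
/-- For a vector space `V` over a field `K`, the map `Y ↦ Y^⊥` (the
coannihilator) is a bijection from the set of finite-dimensional subspaces of the dual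
space `V*` onto the set of finite-codimensional subspaces of `V`. -/
theorem statement10 (K : Type*) [Field K] (V : Type*) [AddCommGroup V] [Module K V] :
    Set.BijOn (fun Y : Submodule K (Module.Dual K V) => Y.dualCoannihilator)
      {Y : Submodule K (Module.Dual K V) | FiniteDimensional K Y}
      {W : Submodule K V | FiniteDimensional K (V ⧸ W)} :=
  Set.InvOn.bijOn (f' := Submodule.dualAnnihilator)
    ⟨fun Y (_ : FiniteDimensional K Y) => Subspace.dualCoannihilator_dualAnnihilator_eq,
      fun _ _ => Subspace.dualAnnihilator_dualCoannihilator_eq⟩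
    (fun _ hY => Subspace.finiteDimensional_quot_dualCoannihilator_iff.mpr hY)
    (fun _ hW => Submodule.finite_dualAnnihilator_iff.mpr hW)
end

section
/- Let K be a field and V a K-vector space. Then the double dual V** is linearly isomorphic to the inverse limit of the finite-dimensional quotients of V: namely, to the submodule of the product ∏ V/W, taken over all subspaces W of V such that V/W is finite-dimensional, consisting of the compatible families (x_W) (those such that whenever W ≤ W', the canonical projection V/W → V/W' sends x_W to x_{W'}). -/
section
variable (K : Type*) [Field K] (V : Type*) [AddCommGroup V] [Module K V]

/-- The inverse limit of the finite-dimensional quotients of `V`: the submodule of the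
product `∏ V/W`, over all finite-codimensional subspaces `W` of `V`, consisting of the
compatible families. -/
def limFinQuot :
    Submodule K (∀ W : {W : Submodule K V // FiniteDimensional K (V ⧸ W)}, V ⧸ W.1) where
  carrier := {x | ∀ (W W' : {W : Submodule K V // FiniteDimensional K (V ⧸ W)})
    (h : W.1 ≤ W'.1), Submodule.mapQ W.1 W'.1 LinearMap.id h (x W) = x W'}
  zero_mem' := by
    intro W W' h
    simp only [Pi.zero_apply, map_zero]
  add_mem' := by
    intro a b ha hb W W' h
    simp only [Pi.add_apply, map_add, ha W W' h, hb W W' h]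
  smul_mem' := by
    intro c a ha W W' h
    simp only [Pi.smul_apply, map_smul, ha W W' h]

namespace limFinQuot

variable {K V}

/-- The kernel of a linear map to a finite-dimensional space, as an index of the limit. -/
def kerIndex {E : Type*} [AddCommGroup E] [Module K E] [FiniteDimensional K E] (f : V →ₗ[K] E) :
    {W : Submodule K V // FiniteDimensional K (V ⧸ W)} :=
  ⟨LinearMap.ker f, f.quotKerEquivRange.symm.finiteDimensional⟩

/-- The value of a linear form on a compatible family can be computed on any quotient through
which the form factors. -/
theorem liftQ_eq_liftQ {x : ∀ W : {W : Submodule K V // FiniteDimensional K (V ⧸ W)}, V ⧸ W.1}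
    (hx : x ∈ limFinQuot K V) {W W' : {W : Submodule K V // FiniteDimensional K (V ⧸ W)}}
    (h : W.1 ≤ W'.1) (f : Module.Dual K V) (hf : W'.1 ≤ LinearMap.ker f) :
    W.1.liftQ f (h.trans hf) (x W) = W'.1.liftQ f hf (x W') := by
  rw [← hx W W' h]
  obtain ⟨v, hv⟩ := W.1.mkQ_surjective (x W)
  rw [← hv]
  rfl

/-- A compatible family evaluates linear forms by passing to the quotient by their kernel. -/
def toDoubleDual (x : limFinQuot K V) : Module.Dual K (Module.Dual K V) where
  toFun f := (LinearMap.ker f).liftQ f le_rfl (x.1 (kerIndex f))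
  map_add' f g := by
    have hf : LinearMap.ker (f.prod g) ≤ LinearMap.ker f := by
      rw [LinearMap.ker_prod]; exact inf_le_left
    have hg : LinearMap.ker (f.prod g) ≤ LinearMap.ker g := by
      rw [LinearMap.ker_prod]; exact inf_le_right
    have hfg : LinearMap.ker (f.prod g) ≤ LinearMap.ker (f + g) := fun v hv => by
      rw [LinearMap.mem_ker, LinearMap.add_apply, hf hv, hg hv, add_zero]
    have key (e : Module.Dual K V) (he : LinearMap.ker (f.prod g) ≤ LinearMap.ker e) :=
      liftQ_eq_liftQ x.2 (W := kerIndex (f.prod g)) (W' := kerIndex e) he e le_rfl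
    refine (key _ hfg).symm.trans (.trans ?_ (congrArg₂ (· + ·) (key f hf) (key g hg)))
    obtain ⟨v, hv⟩ := (kerIndex (f.prod g)).1.mkQ_surjective (x.1 (kerIndex (f.prod g)))
    rw [← hv]
    rfl
  map_smul' c f := by
    have hc : LinearMap.ker f ≤ LinearMap.ker (c • f) := fun v hv => by
      rw [LinearMap.mem_ker, LinearMap.smul_apply, hv, smul_zero]
    refine (liftQ_eq_liftQ x.2 (W := kerIndex f) (W' := kerIndex (c • f)) hc _ le_rfl).symm.trans ?_
    obtain ⟨v, hv⟩ := (kerIndex f).1.mkQ_surjective (x.1 (kerIndex f))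
    change _ = c • (kerIndex f).1.liftQ f le_rfl (x.1 (kerIndex f))
    rw [← hv]
    rfl

theorem toDoubleDual_comp_mkQ (x : limFinQuot K V)
    (W : {W : Submodule K V // FiniteDimensional K (V ⧸ W)}) (φ : Module.Dual K (V ⧸ W.1)) :
    toDoubleDual x (φ ∘ₗ W.1.mkQ) = φ (x.1 W) := by
  have hW : W.1 ≤ LinearMap.ker (φ ∘ₗ W.1.mkQ) := fun v hv => by
    rw [LinearMap.mem_ker, LinearMap.comp_apply, Submodule.mkQ_apply,
      (Submodule.Quotient.mk_eq_zero _).2 hv, map_zero]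
  refine (liftQ_eq_liftQ x.2 (W := W) (W' := kerIndex (φ ∘ₗ W.1.mkQ)) hW _ le_rfl).symm.trans ?_
  obtain ⟨v, hv⟩ := W.1.mkQ_surjective (x.1 W)
  rw [← hv]
  rfl

/-- The image in `V ⧸ W` of an element of the double dual of `V`, using that the
finite-dimensional space `V ⧸ W` is reflexive. -/
noncomputable def component (W : {W : Submodule K V // FiniteDimensional K (V ⧸ W)}) :
    Module.Dual K (Module.Dual K V) →ₗ[K] V ⧸ W.1 :=
  haveI := W.2
  (Module.evalEquiv K (V ⧸ W.1)).symm.toLinearMap ∘ₗ W.1.mkQ.dualMap.dualMap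

theorem apply_component (W : {W : Submodule K V // FiniteDimensional K (V ⧸ W)})
    (L : Module.Dual K (Module.Dual K V)) (φ : Module.Dual K (V ⧸ W.1)) :
    φ (component W L) = L (φ ∘ₗ W.1.mkQ) := by
  have := W.2
  exact Module.apply_evalEquiv_symm_apply _ _ φ (W.1.mkQ.dualMap.dualMap L)

theorem eq_of_forall_dual {E : Type*} [AddCommGroup E] [Module K E] {a b : E}
    (h : ∀ φ : Module.Dual K E, φ a = φ b) : a = b :=
  Module.eval_apply_injective K (LinearMap.ext h)

/-- The canonical map from the double dual to the limit of the finite-dimensional quotients. -/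
noncomputable def ofDoubleDual : Module.Dual K (Module.Dual K V) →ₗ[K] limFinQuot K V :=
  (LinearMap.pi component).codRestrict _ fun L W W' h => eq_of_forall_dual fun φ => by
    change (φ ∘ₗ Submodule.mapQ W.1 W'.1 LinearMap.id h) (component W L) = φ (component W' L)
    rw [apply_component, apply_component]
    rfl

theorem toDoubleDual_ofDoubleDual (L : Module.Dual K (Module.Dual K V)) :
    toDoubleDual (ofDoubleDual L) = L :=
  LinearMap.ext fun f => by
    change (LinearMap.ker f).liftQ f le_rfl (component (kerIndex f) L) = L f
    refine (apply_component (kerIndex f) L ((LinearMap.ker f).liftQ f le_rfl)).trans ?_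
    exact congrArg L (Submodule.liftQ_mkQ _ _ _)

theorem ofDoubleDual_toDoubleDual (x : limFinQuot K V) : ofDoubleDual (toDoubleDual x) = x :=
  Subtype.ext <| funext fun W => eq_of_forall_dual fun φ =>
    (apply_component W _ φ).trans (toDoubleDual_comp_mkQ x W φ)

end limFinQuot

/-- For a vector space `V` over a field `K`, the double dual `V**` is
linearly isomorphic to the inverse limit of the finite-dimensional quotients of `V`. -/
theorem statement12 :
    Nonempty (Module.Dual K (Module.Dual K V) ≃ₗ[K] limFinQuot K V) := by
  exact ⟨{ limFinQuot.ofDoubleDual with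
    invFun := limFinQuot.toDoubleDual
    left_inv := limFinQuot.toDoubleDual_ofDoubleDual
    right_inv := limFinQuot.ofDoubleDual_toDoubleDual }⟩

end
end
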